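/- arXiv:math/9812111 — 2 statements merged into one kernel-verified Lean document; each statement's English description precedes it below -/
import Mathlib

section
/- Let θ > 0, a > 0 and u ∈ ℝ, and let b satisfy 0 ≤ b < −u + 1/a (so in particular 1 − ua > 0). Let g ∈ A_b and set f(z) = e^{uz} g(z). Then for every z ∈ ℂ the integral ∫_0^∞ s^{θ−1} e^{−s} w_θ(sz/a) f(as) ds converges and e^{−z/a} ∫_0^∞ s^{θ−1} e^{−s} w_θ(sz/a) f(as) ds = (1 − ua)^{−θ} e^{uz/(1−ua)} h(z), where h(z) = [exp((a/(1−ua))Δ_θ)g](z/(1−ua)²). Moreover h ∈ A_c with c = b(1−ua)^{−1}(1 − a(u+b))^{−1}. -/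
open Filter Topology MeasureTheory
open scoped ENNReal

/-- The norm `‖f‖_b = sup_{k} b^{-k} |f^{(k)}(0)|`, valued in `ℝ≥0∞`. -/
noncomputable def normB (b : ℝ) (f : ℂ → ℂ) : ℝ≥0∞ :=
  ⨆ k : ℕ, ENNReal.ofReal (‖iteratedDeriv k f 0‖ / b ^ k)

/-- `f ∈ A_a`: `f` is entire and `‖f‖_b < ∞` for every `b > a`. -/
def InA (a : ℝ) (f : ℂ → ℂ) : Prop :=
  Differentiable ℂ f ∧ ∀ b > a, normB b f < ⊤

/-- `q_θ^{(m,k)} = ∏_{l=0}^{k-1} (m-l)(θ+m-1-l)` for `k ≤ m`, and `0` for `k > m`. -/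
noncomputable def qTheta (θ : ℝ) (m k : ℕ) : ℝ :=
  if k ≤ m then ∏ l ∈ Finset.range k, ((m - l : ℝ) * (θ + m - 1 - l)) else 0

/-- `exp(cΔ_θ)g`, i.e. `φ_c(Δ_θ)g` with `φ_c(z) = e^{cz}` (so `φ_c^{(k)}(0) = c^k`):
the function with Taylor coefficients
`h^{(n)}(0) = Σ_k (n!/(k!(n+k)!)) c^k g^{(n+k)}(0) q_θ^{(n+k,k)}`. -/
noncomputable def expDelta (θ c : ℝ) (g : ℂ → ℂ) : ℂ → ℂ := fun z =>
  ∑' n : ℕ,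
    (∑' k : ℕ, ((n.factorial : ℂ) / ((k.factorial : ℂ) * ((n + k).factorial : ℂ))) *
      (c : ℂ) ^ k * iteratedDeriv (n + k) g 0 * (qTheta θ (n + k) k : ℂ)) *
      z ^ n / (n.factorial : ℂ)

/-- `w_θ(z) = Σ_k z^k / (k! Γ(θ+k))`. -/
noncomputable def wTheta (θ : ℝ) (z : ℂ) : ℂ :=
  ∑' k : ℕ, z ^ k / ((k.factorial : ℂ) * (Real.Gamma (θ + k) : ℂ))

/-! ### Multichoose coefficients -/

lemma mc_fact (θ : ℝ) (k : ℕ) :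
    (k.factorial : ℝ) * Ring.multichoose θ k = (ascPochhammer ℝ k).eval θ := by
  have := Ring.factorial_nsmul_multichoose_eq_ascPochhammer θ k
  rw [nsmul_eq_mul, Polynomial.ascPochhammer_smeval_eq_eval] at this
  exact this

lemma mc_succ (θ : ℝ) (k : ℕ) :
    ((k + 1).factorial : ℝ) * Ring.multichoose θ (k + 1) =
      (k.factorial : ℝ) * Ring.multichoose θ k * (θ + k) := by
  rw [mc_fact, mc_fact, ascPochhammer_succ_eval]

lemma mc_nonneg (θ : ℝ) (hθ : 0 < θ) (k : ℕ) : 0 ≤ Ring.multichoose θ k := by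
  have h := ascPochhammer_pos k θ hθ
  rw [← mc_fact] at h
  have hk : (0 : ℝ) < k.factorial := by positivity
  exact (pos_of_mul_pos_right h hk.le).le

lemma mc_gamma (θ : ℝ) (hθ : 0 < θ) (k : ℕ) :
    Real.Gamma (θ + k) = (k.factorial : ℝ) * Ring.multichoose θ k * Real.Gamma θ := by
  induction k with
  | zero => simp
  | succ k ih =>
    rw [mc_succ]
    have : θ + ((k + 1 : ℕ) : ℝ) = (θ + k) + 1 := by push_cast; ring
    rw [this, Real.Gamma_add_one (by positivity), ih]
    ring

lemma mc_q (θ : ℝ) (n k : ℕ) :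
    qTheta θ (n + k) k * (n.factorial : ℝ) =
      ((n + k).factorial : ℝ) * ((k.factorial : ℝ) * Ring.multichoose (θ + n) k) := by
  unfold qTheta
  rw [if_pos (by omega)]
  induction k with
  | zero => simp
  | succ k ih =>
    rw [mc_succ, Finset.prod_range_succ']
    have e : ∀ l ∈ Finset.range k, (((n + (k + 1) : ℕ) : ℝ) - ((l + 1 : ℕ) : ℝ)) *
        (θ + ((n + (k + 1) : ℕ) : ℝ) - 1 - ((l + 1 : ℕ) : ℝ)) =
        (((n + k : ℕ) : ℝ) - l) * (θ + ((n + k : ℕ) : ℝ) - 1 - l) := by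
      intro l _
      push_cast
      ring
    rw [Finset.prod_congr rfl e]
    have e2 : ((n + (k + 1)).factorial : ℝ) = (n + k + 1) * ((n + k).factorial : ℝ) := by
      rw [← add_assoc, Nat.factorial_succ]; push_cast; ring
    rw [e2]
    push_cast at ih ⊢
    linear_combination ((n : ℝ) + k + 1) * (θ + n + k) * ih

lemma mc_hasSum (θ y : ℝ) (hy0 : 0 ≤ y) (hy : y < 1) :
    HasSum (fun k : ℕ => Ring.multichoose θ k * y ^ k) ((1 - y) ^ (-θ)) := by
  have h := (Real.one_div_one_sub_rpow_hasFPowerSeriesOnBall_zero θ).hasSum (y := y) (by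
    simp [Real.enorm_eq_ofReal hy0, hy])
  simp only [FormalMultilinearSeries.ofScalars_apply_eq, smul_eq_mul, zero_add,
    ← Ring.multichoose_eq] at h
  rw [Real.rpow_neg (by linarith), ← one_div]
  exact h

/-- Vandermonde -/
lemma mc_vandermonde (j : ℕ) : ∀ (θ : ℝ) (m : ℕ), Ring.multichoose (θ + j) m =
    ∑ p ∈ Finset.HasAntidiagonal.antidiagonal m, Ring.multichoose (θ + p.1) p.2 * (j.choose p.1 : ℝ) := by
  induction j with
  | zero =>
    intro θ m
    cases m with
    | zero => simp
    | succ m => rw [Finset.Nat.antidiagonal_succ]; simp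
  | succ j ih =>
    intro θ m
    cases m with
    | zero => simp
    | succ m =>
      have e : θ + ((j + 1 : ℕ) : ℝ) = (θ + j) + 1 := by push_cast; ring
      rw [e, Ring.multichoose_succ_succ, ih θ (m + 1)]
      have e' : θ + j + 1 = (θ + 1) + j := by ring
      rw [e', ih (θ + 1) m, Finset.Nat.antidiagonal_succ, Finset.sum_cons, Finset.sum_cons,
        Finset.sum_map, Finset.sum_map, add_assoc, ← Finset.sum_add_distrib]
      congr 1
      · simp
      · refine Finset.sum_congr rfl fun p _ => ?_
        simp [Nat.choose_succ_succ]
        have : θ + ((p.1 : ℝ) + 1) = θ + 1 + p.1 := by ring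
        rw [this]
        ring

lemma mc_summable (θ y X : ℝ) (hθ : 0 < θ) (hy0 : 0 ≤ y) (hy : y < 1) (hX : 0 ≤ X) :
    Summable (fun p : ℕ × ℕ => Ring.multichoose (θ + p.1) p.2 * y ^ p.2 *
      (X ^ p.1 / (p.1.factorial : ℝ))) := by
  have h1 : ∀ n : ℕ, HasSum (fun k : ℕ => Ring.multichoose (θ + n) k * y ^ k *
      (X ^ n / (n.factorial : ℝ))) ((1 - y) ^ (-(θ + n)) * (X ^ n / (n.factorial : ℝ))) :=
    fun n => (mc_hasSum (θ + n) y hy0 hy).mul_right _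
  rw [summable_prod_of_nonneg]
  · refine ⟨fun n => (h1 n).summable, ?_⟩
    simp only [(h1 _).tsum_eq]
    have := (Real.summable_pow_div_factorial (X / (1 - y))).mul_left ((1 - y) ^ (-θ))
    refine this.congr fun n => ?_
    have hp : 0 < 1 - y := by linarith
    rw [neg_add, Real.rpow_add hp, Real.rpow_neg hp.le (n : ℝ), Real.rpow_natCast, div_pow]
    field_simp
  · intro p
    have := mc_nonneg (θ + p.1) (by positivity) p.2
    simp only [Pi.zero_apply]
    positivity

lemma hasSum_congr_aux {ι : Type*} {f g : ι → ℂ} {s : ℂ} (h : ∀ i, f i = g i) :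
    HasSum f s ↔ HasSum g s := by
  rw [funext h]

/-- Kummer type identity -/
lemma kummer (θ : ℝ) (x : ℂ) (m : ℕ) :
    HasSum (fun j : ℕ => ((Ring.multichoose (θ + j) m : ℝ) : ℂ) * (x ^ j / (j.factorial : ℂ)))
      (∑ p ∈ Finset.HasAntidiagonal.antidiagonal m, ((Ring.multichoose (θ + p.1) p.2 : ℝ) : ℂ) *
        (x ^ p.1 / (p.1.factorial : ℂ)) * Complex.exp x) := by
  have hexp : HasSum (fun j : ℕ => x ^ j / (j.factorial : ℂ)) (Complex.exp x) := by
    rw [Complex.exp_eq_exp_ℂ]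
    exact NormedSpace.expSeries_div_hasSum_exp x
  have h1 : ∀ n : ℕ, HasSum (fun j : ℕ => (j.choose n : ℂ) * (x ^ j / (j.factorial : ℂ)))
      (x ^ n / (n.factorial : ℂ) * Complex.exp x) := by
    intro n
    rw [← hasSum_nat_add_iff' n]
    have h0 : ∑ i ∈ Finset.range n, (i.choose n : ℂ) * (x ^ i / (i.factorial : ℂ)) = 0 := by
      refine Finset.sum_eq_zero fun i hi => ?_
      rw [Nat.choose_eq_zero_of_lt (Finset.mem_range.1 hi)]
      simp
    rw [h0, sub_zero]
    refine (hasSum_congr_aux fun l => ?_).2 (hexp.mul_left (x ^ n / (n.factorial : ℂ)))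
    have hc : (((l + n).choose n : ℕ) : ℂ) * (l.factorial : ℂ) * (n.factorial : ℂ) =
        ((l + n).factorial : ℂ) := by
      have := Nat.add_choose_mul_factorial_mul_factorial l n
      exact_mod_cast this
    have f1 : ((l + n).factorial : ℂ) ≠ 0 := by exact_mod_cast Nat.factorial_ne_zero _
    have f2 : (l.factorial : ℂ) ≠ 0 := by exact_mod_cast Nat.factorial_ne_zero _
    have f3 : (n.factorial : ℂ) ≠ 0 := by exact_mod_cast Nat.factorial_ne_zero _
    field_simp
    rw [← hc, pow_add]
    ring
  have h2 := hasSum_sum (s := Finset.HasAntidiagonal.antidiagonal m) (fun p _ =>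
    (h1 p.1).mul_left ((Ring.multichoose (θ + p.1) p.2 : ℝ) : ℂ))
  simp only [mul_assoc] at h2 ⊢
  refine (hasSum_congr_aux fun j => ?_).2 h2
  rw [mc_vandermonde j θ m]
  push_cast
  rw [Finset.sum_mul]
  simp only [mul_assoc]

/-! ### Entire functions from coefficients -/

lemma summable_coef (H : ℕ → ℂ) (K ρ : ℝ) (hH : ∀ n, ‖H n‖ ≤ K * ρ ^ n) (x : ℝ)
    (hx : 0 ≤ x) : Summable (fun n => ‖H n / (n.factorial : ℂ)‖ * x ^ n) := by
  refine Summable.of_nonneg_of_le (fun n => by positivity) (fun n => ?_)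
    ((Real.summable_pow_div_factorial (ρ * x)).mul_left K)
  rw [norm_div, Complex.norm_natCast, mul_pow]
  have hf : (0 : ℝ) < n.factorial := by positivity
  have := mul_le_mul_of_nonneg_right (hH n) (by positivity : 0 ≤ x ^ n / (n.factorial : ℝ))
  calc _ = ‖H n‖ * (x ^ n / (n.factorial : ℝ)) := by ring
    _ ≤ _ := this
    _ = _ := by ring

lemma entire_of_coef (H : ℕ → ℂ) (K ρ : ℝ) (hH : ∀ n, ‖H n‖ ≤ K * ρ ^ n) :
    Differentiable ℂ (fun z : ℂ => ∑' n : ℕ, H n * z ^ n / (n.factorial : ℂ)) ∧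
    ∀ n, iteratedDeriv n (fun z : ℂ => ∑' n : ℕ, H n * z ^ n / (n.factorial : ℂ)) 0 = H n := by
  set p : FormalMultilinearSeries ℂ ℂ ℂ :=
    FormalMultilinearSeries.ofScalars ℂ (fun n => H n / (n.factorial : ℂ)) with hp
  have hrad : p.radius = ⊤ := by
    refine ENNReal.eq_top_of_forall_nnreal_le fun r => ?_
    refine p.le_radius_of_summable ?_
    refine (summable_coef H K ρ hH r r.2).congr fun n => ?_
    rw [hp, FormalMultilinearSeries.ofScalars_norm]
  have hball : HasFPowerSeriesOnBall (fun z : ℂ => ∑' n : ℕ, H n * z ^ n / (n.factorial : ℂ))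
      p 0 ⊤ := by
    have h := p.hasFPowerSeriesOnBall (by rw [hrad]; exact ENNReal.zero_lt_top)
    rw [hrad] at h
    refine h.congr fun z _ => ?_
    simp only [FormalMultilinearSeries.sum, hp, FormalMultilinearSeries.ofScalars_apply_eq,
      smul_eq_mul]
    exact tsum_congr fun n => by ring
  have hdiff : Differentiable ℂ (fun z : ℂ => ∑' n : ℕ, H n * z ^ n / (n.factorial : ℂ)) := by
    have := hball.differentiableOn
    intro z
    exact (this z (by simp)).differentiableAt (by simp)
  refine ⟨hdiff, fun n => ?_⟩
  have h2 := (hdiff.analyticAt 0).hasFPowerSeriesAt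
  have h3 := congrArg (FormalMultilinearSeries.coeff · n)
    (hball.hasFPowerSeriesAt.eq_formalMultilinearSeries h2)
  simp only [hp, FormalMultilinearSeries.coeff_ofScalars] at h3
  have hf : (n.factorial : ℂ) ≠ 0 := by exact_mod_cast Nat.factorial_ne_zero _
  field_simp at h3
  exact h3.symm

lemma normB_bound (β : ℝ) (hβ : 0 < β) (g : ℂ → ℂ) (h : normB β g < ⊤) :
    ∃ M : ℝ, 0 ≤ M ∧ ∀ k, ‖iteratedDeriv k g 0‖ ≤ M * β ^ k := by
  refine ⟨(normB β g).toReal, ENNReal.toReal_nonneg, fun k => ?_⟩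
  have h1 : ENNReal.ofReal (‖iteratedDeriv k g 0‖ / β ^ k) ≤ normB β g :=
    le_iSup (fun k : ℕ => ENNReal.ofReal (‖iteratedDeriv k g 0‖ / β ^ k)) k
  have h2 := ENNReal.toReal_mono h.ne h1
  rw [ENNReal.toReal_ofReal (by positivity)] at h2
  rwa [div_le_iff₀ (by positivity)] at h2

lemma normB_lt_top (β : ℝ) (hβ : 0 < β) (h : ℂ → ℂ) (K : ℝ)
    (hK : ∀ k, ‖iteratedDeriv k h 0‖ ≤ K * β ^ k) : normB β h < ⊤ := by
  refine lt_of_le_of_lt (iSup_le fun k => ?_) (ENNReal.ofReal_lt_top (r := K))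
  refine ENNReal.ofReal_le_ofReal ?_
  rw [div_le_iff₀ (by positivity)]
  exact hK k

/-! ### Integration of a series -/

lemma integrable_tsum_of_summable {ι : Type*} [Countable ι] {μ : Measure ℝ} (F : ι → ℝ → ℂ)
    (hF : ∀ i, Integrable (F i) μ) (hs : Summable fun i => ∫ a, ‖F i a‖ ∂μ)
    (f : ℝ → ℂ) (hf : ∀ᵐ a ∂μ, HasSum (fun i => F i a) (f a)) :
    Integrable f μ := by
  have hm : AEStronglyMeasurable f μ := by
    refine aestronglyMeasurable_of_tendsto_ae (atTop : Filter (Finset ι))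
      (f := fun (s : Finset ι) a => ∑ i ∈ s, F i a) (fun s => ?_) ?_
    · exact Finset.aestronglyMeasurable_fun_sum s fun i _ => (hF i).1
    · filter_upwards [hf] with a ha
      simpa [HasSum] using ha
  refine ⟨hm, ?_⟩
  have h1 : ∫⁻ a, ‖f a‖ₑ ∂μ ≤ ∫⁻ a, ∑' i, ‖F i a‖ₑ ∂μ := by
    refine lintegral_mono_ae ?_
    filter_upwards [hf] with a ha
    rw [← ha.tsum_eq]
    exact enorm_tsum_le_tsum_enorm
  refine lt_of_le_of_lt h1 ?_
  rw [lintegral_tsum fun i => (hF i).1.enorm]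
  have h2 : ∀ i, ∫⁻ a, ‖F i a‖ₑ ∂μ = ENNReal.ofReal (∫ a, ‖F i a‖ ∂μ) := fun i =>
    (ofReal_integral_norm_eq_lintegral_enorm (hF i)).symm
  simp only [h2]
  exact hs.tsum_ofReal_lt_top

/-! ### The operator -/

noncomputable def coefD (θ c : ℝ) (g : ℂ → ℂ) (n : ℕ) : ℂ :=
  ∑' k : ℕ, (c : ℂ) ^ k * iteratedDeriv (n + k) g 0 * ((Ring.multichoose (θ + n) k : ℝ) : ℂ)

lemma expDelta_eq (θ c : ℝ) (g : ℂ → ℂ) (z : ℂ) :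
    expDelta θ c g z = ∑' n : ℕ, coefD θ c g n * z ^ n / (n.factorial : ℂ) := by
  unfold expDelta coefD
  refine tsum_congr fun n => ?_
  congr 2
  refine tsum_congr fun k => ?_
  have h := mc_q θ n k
  have h' : (qTheta θ (n + k) k : ℂ) * (n.factorial : ℂ) =
      ((n + k).factorial : ℂ) * ((k.factorial : ℂ) * ((Ring.multichoose (θ + n) k : ℝ) : ℂ)) := by
    exact_mod_cast h
  have f1 : ((n + k).factorial : ℂ) ≠ 0 := by exact_mod_cast Nat.factorial_ne_zero _
  have f2 : (k.factorial : ℂ) ≠ 0 := by exact_mod_cast Nat.factorial_ne_zero _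
  field_simp
  linear_combination (c : ℂ) ^ k * iteratedDeriv (n + k) g 0 * h'

lemma coefD_term_bound (θ c β M : ℝ) (hθ : 0 < θ) (hc : 0 < c)
    (g : ℂ → ℂ) (hM : ∀ k, ‖iteratedDeriv k g 0‖ ≤ M * β ^ k) (n k : ℕ) :
    ‖(c : ℂ) ^ k * iteratedDeriv (n + k) g 0 * ((Ring.multichoose (θ + n) k : ℝ) : ℂ)‖ ≤
      M * β ^ n * (Ring.multichoose (θ + n) k * (c * β) ^ k) := by
  have h0 := mc_nonneg (θ + n) (by positivity) k
  rw [norm_mul, norm_mul, norm_pow, Complex.norm_real, Complex.norm_real,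
    Real.norm_of_nonneg hc.le, Real.norm_of_nonneg h0]
  calc _ ≤ c ^ k * (M * β ^ (n + k)) * Ring.multichoose (θ + n) k := by
        gcongr
        exact hM _
    _ = _ := by rw [mul_pow, pow_add]; ring

lemma coefD_bound (θ c β M : ℝ) (hθ : 0 < θ) (hc : 0 < c) (hβ : 0 < β) (hcβ : c * β < 1)
    (g : ℂ → ℂ) (hM : ∀ k, ‖iteratedDeriv k g 0‖ ≤ M * β ^ k) (n : ℕ) :
    ‖coefD θ c g n‖ ≤ M * (1 - c * β) ^ (-θ) * (β / (1 - c * β)) ^ n := by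
  have h := (mc_hasSum (θ + n) (c * β) (by positivity) hcβ).mul_left (M * β ^ n)
  have h1 := tsum_of_norm_bounded h (coefD_term_bound θ c β M hθ hc g hM n)
  refine h1.trans (le_of_eq ?_)
  have hp : 0 < 1 - c * β := by linarith
  rw [neg_add, Real.rpow_add hp, Real.rpow_neg hp.le (n : ℝ), Real.rpow_natCast, div_pow]
  field_simp

lemma part3 (θ a u b : ℝ) (hθ : 0 < θ) (ha : 0 < a)
    (hb0 : 0 ≤ b) (hb : b < -u + 1 / a) (g : ℂ → ℂ) (hg : InA b g) :
    InA (b * (1 - u * a)⁻¹ * (1 - a * (u + b))⁻¹)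
      (fun z => expDelta θ (a / (1 - u * a)) g (z / (((1 - u * a) ^ 2 : ℝ) : ℂ))) := by
  obtain ⟨r, hr⟩ : ∃ r, r = 1 - u * a := ⟨_, rfl⟩
  have hab : a * b < r := by
    have := mul_lt_mul_of_pos_left hb ha
    rw [mul_add, mul_one_div_cancel ha.ne'] at this
    rw [hr]; linarith
  have hr0 : 0 < r := lt_of_le_of_lt (by positivity) hab
  have e1 : 1 - a * (u + b) = r - a * b := by rw [hr]; ring
  rw [e1, ← hr]
  -- the function as a power series
  have hfun : (fun z : ℂ => expDelta θ (a / r) g (z / ((r ^ 2 : ℝ) : ℂ))) =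
      fun z : ℂ => ∑' n : ℕ, (coefD θ (a / r) g n / ((r ^ 2 : ℝ) : ℂ) ^ n) * z ^ n /
        (n.factorial : ℂ) := by
    funext z
    rw [expDelta_eq]
    refine tsum_congr fun n => ?_
    rw [div_pow]
    ring
  rw [hfun]
  have key : ∀ β, b < β → a * β < r → ∃ K, ∀ n,
      ‖coefD θ (a / r) g n / ((r ^ 2 : ℝ) : ℂ) ^ n‖ ≤ K * (β / (r * (r - a * β))) ^ n := by
    intro β hβ haβ
    have hβ0 : 0 < β := lt_of_le_of_lt hb0 hβ
    obtain ⟨M, hM0, hM⟩ := normB_bound β hβ0 g (hg.2 β hβ)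
    refine ⟨M * (1 - a / r * β) ^ (-θ), fun n => ?_⟩
    have hlt : a / r * β < 1 := by rw [div_mul_eq_mul_div, div_lt_one hr0]; exact haβ
    have h := coefD_bound θ (a / r) β M hθ (by positivity) hβ0 hlt g hM n
    rw [norm_div, norm_pow, Complex.norm_real, Real.norm_of_nonneg (by positivity : 0 ≤ r ^ 2),
      div_le_iff₀ (by positivity), mul_assoc, ← mul_pow]
    have e : β / (r * (r - a * β)) * r ^ 2 = β / (1 - a / r * β) := by
      have : r - a * β ≠ 0 := by linarith
      have h2 : 1 - a / r * β = (r - a * β) / r := by field_simp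
      rw [h2]
      field_simp
    rw [e]
    exact h
  have hcont : ContinuousAt (fun β : ℝ => β / (r * (r - a * β))) b := by
    refine ContinuousAt.div (by fun_prop) (by fun_prop) ?_
    have : 0 < r - a * b := by linarith
    positivity
  have hev : ∀ᶠ β in 𝓝[>] b, b < β ∧ a * β < r := by
    have h1 : ∀ᶠ β in 𝓝[>] b, b < β := self_mem_nhdsWithin
    have h2 : ∀ᶠ β in 𝓝 b, a * β < r :=
      (by fun_prop : ContinuousAt (fun β : ℝ => a * β) b).eventually_lt continuousAt_const hab
    exact h1.and (h2.filter_mono nhdsWithin_le_nhds)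
  obtain ⟨β₀, hβ₀⟩ := hev.exists
  obtain ⟨K₀, hK₀⟩ := key β₀ hβ₀.1 hβ₀.2
  obtain ⟨hd, hit⟩ := entire_of_coef _ K₀ _ hK₀
  refine ⟨hd, fun b' hb' => ?_⟩
  have hbb : b / (r * (r - a * b)) < b' := by
    have : b * r⁻¹ * (r - a * b)⁻¹ = b / (r * (r - a * b)) := by
      rw [div_eq_mul_inv, mul_inv, mul_assoc]
    rw [← this]; exact hb'
  have hev2 : ∀ᶠ β in 𝓝[>] b, β / (r * (r - a * β)) < b' :=
    (hcont.eventually_lt continuousAt_const hbb).filter_mono nhdsWithin_le_nhds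
  obtain ⟨β, ⟨hβ1, hβ2⟩, hβ3⟩ := (hev.and hev2).exists
  obtain ⟨K, hK⟩ := key β hβ1 hβ2
  have hpos : 0 < β / (r * (r - a * β)) := by
    have : 0 < r - a * β := by linarith
    have : 0 < β := by linarith
    positivity
  refine normB_lt_top b' (hpos.trans hβ3) _ K fun k => ?_
  rw [hit k]
  have hK0 : 0 ≤ K := by
    have := (norm_nonneg _).trans (hK 0)
    simpa using this
  refine (hK k).trans ?_
  gcongr

/-! ### The integral -/

lemma hasSum_mul_aux {f g : ℕ → ℂ} {s t : ℂ} (hf : HasSum f s) (hg : HasSum g t)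
    (hf' : Summable fun n => ‖f n‖) (hg' : Summable fun n => ‖g n‖) :
    HasSum (fun p : ℕ × ℕ => f p.1 * g p.2) (s * t) :=
  hf.mul hg (summable_mul_of_summable_norm hf' hg')

lemma w_summable (θ : ℝ) (hθ : 0 < θ) (x : ℂ) :
    Summable fun k : ℕ => ‖x ^ k / ((k.factorial : ℂ) * (Real.Gamma (θ + k) : ℂ))‖ := by
  -- `Γ(θ+k)` is bounded below along the naturals
  obtain ⟨K, hK⟩ : ∃ K : ℝ, ∀ k : ℕ, (Real.Gamma (θ + k))⁻¹ ≤ K * (θ⁻¹) ^ k := by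
    refine ⟨(Real.Gamma θ)⁻¹, fun k => ?_⟩
    induction k with
    | zero => simp
    | succ k ih =>
      have e : θ + ((k + 1 : ℕ) : ℝ) = (θ + k) + 1 := by push_cast; ring
      rw [e, Real.Gamma_add_one (by positivity), mul_inv, pow_succ', mul_left_comm]
      have h1 : (θ + k)⁻¹ ≤ θ⁻¹ := by
        gcongr
        simp
      have h2 : 0 ≤ (Real.Gamma (θ + k))⁻¹ := inv_nonneg.2 (Real.Gamma_pos_of_pos (by positivity)).le
      exact mul_le_mul h1 ih h2 (by positivity)
  refine Summable.of_nonneg_of_le (fun n => by positivity) (fun n => ?_)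
    ((Real.summable_pow_div_factorial (‖x‖ * θ⁻¹)).mul_left K)
  have hΓ := Real.Gamma_pos_of_pos (show 0 < θ + (n : ℝ) by positivity)
  rw [norm_div, norm_mul, norm_pow, Complex.norm_natCast, Complex.norm_real,
    Real.norm_of_nonneg hΓ.le, mul_pow]
  calc _ = ‖x‖ ^ n / (n.factorial : ℝ) * (Real.Gamma (θ + n))⁻¹ := by field_simp
    _ ≤ ‖x‖ ^ n / (n.factorial : ℝ) * (K * (θ⁻¹) ^ n) := by gcongr; exact hK n
    _ = _ := by ring

set_option maxHeartbeats 1000000 in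
lemma part12 (θ a u b : ℝ) (hθ : 0 < θ) (ha : 0 < a)
    (hb0 : 0 ≤ b) (hb : b < -u + 1 / a) (g : ℂ → ℂ) (hg : InA b g) (z : ℂ) :
    (IntegrableOn
        (fun s : ℝ => ((s ^ (θ - 1) * Real.exp (-s) : ℝ) : ℂ) * wTheta θ ((s : ℂ) * z / a) *
          (Complex.exp ((u * (a * s) : ℝ) : ℂ) * g ((a : ℂ) * s))) (Set.Ioi 0)) ∧
    (Complex.exp (-z / a) *
        ∫ s in Set.Ioi (0 : ℝ),
          ((s ^ (θ - 1) * Real.exp (-s) : ℝ) : ℂ) * wTheta θ ((s : ℂ) * z / a) *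
            (Complex.exp ((u * (a * s) : ℝ) : ℂ) * g ((a : ℂ) * s)) =
      (((1 - u * a) ^ (-θ) : ℝ) : ℂ) * Complex.exp ((u : ℂ) * z / ((1 - u * a : ℝ) : ℂ)) *
        expDelta θ (a / (1 - u * a)) g (z / (((1 - u * a) ^ 2 : ℝ) : ℂ))) := by
  obtain ⟨r, hr⟩ : ∃ r, r = 1 - u * a := ⟨_, rfl⟩
  have hab : a * b < r := by
    have := mul_lt_mul_of_pos_left hb ha
    rw [mul_add, mul_one_div_cancel ha.ne'] at this
    rw [hr]; linarith
  have hr0 : 0 < r := lt_of_le_of_lt (by positivity) hab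
  obtain ⟨β, hβ, haβ⟩ : ∃ β, b < β ∧ a * β < r := by
    obtain ⟨β, h1, h2⟩ := exists_between ((lt_div_iff₀' ha).2 hab)
    exact ⟨β, h1, (lt_div_iff₀' ha).1 h2⟩
  have hβ0 : 0 < β := lt_of_le_of_lt hb0 hβ
  obtain ⟨M, hM0, hM⟩ := normB_bound β hβ0 g (hg.2 β hβ)
  obtain ⟨c, hc⟩ : ∃ c, c = a / r := ⟨_, rfl⟩
  have hc0 : 0 < c := by rw [hc]; positivity
  have hcβ : c * β < 1 := by rw [hc, div_mul_eq_mul_div, div_lt_one hr0]; exact haβ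
  obtain ⟨x, hx⟩ : ∃ x : ℂ, x = z / (a * r) := ⟨_, rfl⟩
  have haC : (a : ℂ) ≠ 0 := by exact_mod_cast ha.ne'
  have hrC : (r : ℂ) ≠ 0 := by exact_mod_cast hr0.ne'
  rw [← hr, ← hc]
  -- the terms
  let C : ℕ × ℕ → ℂ := fun p => (z / a) ^ p.1 / ((p.1.factorial : ℂ) * (Real.Gamma (θ + p.1) : ℂ)) *
    (iteratedDeriv p.2 g 0 * (a : ℂ) ^ p.2 / (p.2.factorial : ℂ))
  let F : ℕ × ℕ → ℝ → ℂ := fun p s =>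
    C p * ((s ^ (θ + p.1 + p.2 - 1) * Real.exp (-(r * s)) : ℝ) : ℂ)
  let V : ℕ × ℕ → ℂ := fun p => ((r ^ (-θ) : ℝ) : ℂ) * (iteratedDeriv p.2 g 0 * (c : ℂ) ^ p.2) *
    (((Ring.multichoose (θ + p.1) p.2 : ℝ) : ℂ) * (x ^ p.1 / (p.1.factorial : ℂ)))
  have hint0 : ∀ p : ℕ × ℕ, IntegrableOn
      (fun s : ℝ => s ^ (θ + p.1 + p.2 - 1) * Real.exp (-(r * s))) (Set.Ioi 0) := by
    intro p
    have := integrableOn_rpow_mul_exp_neg_mul_rpow (p := 1) (s := θ + p.1 + p.2 - 1) (b := r)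
      (by have : 0 < θ + p.1 + p.2 := by positivity
          linarith) one_pos hr0
    simpa using this
  have hval0 : ∀ p : ℕ × ℕ,
      ∫ s in Set.Ioi (0 : ℝ), s ^ (θ + p.1 + p.2 - 1) * Real.exp (-(r * s)) =
      r ^ (-θ) * (r ^ p.1)⁻¹ * (r ^ p.2)⁻¹ *
        ((p.2.factorial : ℝ) * Ring.multichoose (θ + p.1) p.2 * Real.Gamma (θ + p.1)) := by
    intro p
    rw [Real.integral_rpow_mul_exp_neg_mul_Ioi (by positivity) hr0, mc_gamma _ (by positivity)]
    congr 1
    rw [one_div, Real.inv_rpow hr0.le, ← Real.rpow_neg hr0.le, neg_add, neg_add,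
      Real.rpow_add hr0, Real.rpow_add hr0, Real.rpow_neg hr0.le (p.1 : ℝ),
      Real.rpow_neg hr0.le (p.2 : ℝ), Real.rpow_natCast, Real.rpow_natCast]
  have hF : ∀ p, Integrable (F p) (volume.restrict (Set.Ioi 0)) := fun p =>
    ((hint0 p).ofReal (𝕜 := ℂ)).const_mul (C p)
  have hCV : ∀ p : ℕ × ℕ, C p * ((r ^ (-θ) * (r ^ p.1)⁻¹ * (r ^ p.2)⁻¹ *
      ((p.2.factorial : ℝ) * Ring.multichoose (θ + p.1) p.2 * Real.Gamma (θ + p.1)) : ℝ) : ℂ)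
      = V p := by
    intro p
    have hΓ := Real.Gamma_pos_of_pos (show 0 < θ + (p.1 : ℝ) by positivity)
    have hΓ' : (Real.Gamma (θ + p.1) : ℂ) ≠ 0 := by exact_mod_cast hΓ.ne'
    have f2 : (p.2.factorial : ℂ) ≠ 0 := by exact_mod_cast Nat.factorial_ne_zero _
    have f1 : (p.1.factorial : ℂ) ≠ 0 := by exact_mod_cast Nat.factorial_ne_zero _
    simp only [C, V, hx, hc]
    push_cast
    generalize (Real.Gamma (θ + p.1) : ℂ) = G at *
    rw [div_pow, div_pow, div_pow, mul_pow]
    field_simp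
  have hFint : ∀ p, ∫ s in Set.Ioi (0 : ℝ), F p s = V p := by
    intro p
    simp only [F]
    rw [integral_const_mul, integral_complex_ofReal, hval0, hCV]
  have hFnorm : ∀ p, ∫ s in Set.Ioi (0 : ℝ), ‖F p s‖ = ‖V p‖ := by
    intro p
    have hnn : 0 ≤ ∫ s in Set.Ioi (0 : ℝ), s ^ (θ + p.1 + p.2 - 1) * Real.exp (-(r * s)) :=
      setIntegral_nonneg measurableSet_Ioi fun s hs => by
        have : (0 : ℝ) < s := hs
        positivity
    rw [← hCV, norm_mul, Complex.norm_real, ← hval0, Real.norm_of_nonneg hnn, ← integral_const_mul]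
    refine setIntegral_congr_fun measurableSet_Ioi fun s hs => ?_
    have hs' : (0 : ℝ) < s := hs
    simp only [F]
    rw [norm_mul, Complex.norm_real, Real.norm_of_nonneg (by positivity)]
  have hVs : Summable fun p => ‖V p‖ := by
    refine Summable.of_nonneg_of_le (fun n => by positivity) (fun p => ?_)
      ((mc_summable θ (c * β) ‖x‖ hθ (by positivity) hcβ (norm_nonneg _)).mul_left
        (r ^ (-θ) * M))
    have h0 := mc_nonneg (θ + p.1) (by positivity) p.2
    have hrθ : 0 ≤ r ^ (-θ) := by positivity
    simp only [V]
    rw [norm_mul, norm_mul, norm_mul, norm_mul, norm_div, norm_pow, norm_pow, Complex.norm_real,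
      Complex.norm_real, Complex.norm_real, Complex.norm_natCast, Real.norm_of_nonneg hc0.le,
      Real.norm_of_nonneg h0, Real.norm_of_nonneg hrθ]
    calc _ ≤ r ^ (-θ) * (M * β ^ p.2 * c ^ p.2) *
          (Ring.multichoose (θ + p.1) p.2 * (‖x‖ ^ p.1 / (p.1.factorial : ℝ))) := by
          gcongr
          exact hM _
      _ = _ := by rw [mul_pow]; ring
  have hFs : Summable fun p => ∫ s in Set.Ioi (0 : ℝ), ‖F p s‖ := by
    simpa only [hFnorm] using hVs
  -- pointwise expansion
  have hpt : ∀ s ∈ Set.Ioi (0 : ℝ), HasSum (fun p => F p s)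
      (((s ^ (θ - 1) * Real.exp (-s) : ℝ) : ℂ) * wTheta θ ((s : ℂ) * z / a) *
          (Complex.exp ((u * (a * s) : ℝ) : ℂ) * g ((a : ℂ) * s))) := by
    intro s hs
    have hs' : (0 : ℝ) < s := hs
    have hw := w_summable θ hθ ((s : ℂ) * z / a)
    have hgs := summable_coef (fun n => iteratedDeriv n g 0) M β hM (a * s) (by positivity)
    have hgs' : Summable fun n : ℕ =>
        ‖iteratedDeriv n g 0 / (n.factorial : ℂ) * ((a : ℂ) * s) ^ n‖ := by
      refine hgs.congr fun n => ?_
      rw [norm_mul, norm_pow, norm_mul, Complex.norm_real, Complex.norm_real,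
        Real.norm_of_nonneg ha.le, Real.norm_of_nonneg hs'.le]
    have hgt : HasSum (fun n : ℕ => iteratedDeriv n g 0 / (n.factorial : ℂ) * ((a : ℂ) * s) ^ n)
        (g ((a : ℂ) * s)) := by
      have := Complex.hasSum_taylorSeries_of_entire hg.1 0 ((a : ℂ) * s)
      refine (hasSum_congr_aux fun n => ?_).1 this
      simp only [sub_zero, smul_eq_mul]
      ring
    have hwt : HasSum (fun k : ℕ => ((s : ℂ) * z / a) ^ k /
        ((k.factorial : ℂ) * (Real.Gamma (θ + k) : ℂ))) (wTheta θ ((s : ℂ) * z / a)) :=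
      hw.of_norm.hasSum
    have hprod := (hasSum_mul_aux hwt hgt hw hgs').mul_left
      (((s ^ (θ - 1) * Real.exp (-s) : ℝ) : ℂ) * Complex.exp ((u * (a * s) : ℝ) : ℂ))
    have e : ((s ^ (θ - 1) * Real.exp (-s) : ℝ) : ℂ) * Complex.exp ((u * (a * s) : ℝ) : ℂ) *
        (wTheta θ ((s : ℂ) * z / a) * g ((a : ℂ) * s)) =
        ((s ^ (θ - 1) * Real.exp (-s) : ℝ) : ℂ) * wTheta θ ((s : ℂ) * z / a) *
          (Complex.exp ((u * (a * s) : ℝ) : ℂ) * g ((a : ℂ) * s)) := by ring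
    rw [← e]
    refine (hasSum_congr_aux fun p => ?_).1 hprod
    have e2 : s ^ (θ + p.1 + p.2 - 1) * Real.exp (-(r * s)) =
        s ^ (θ - 1) * Real.exp (-s) * Real.exp (u * (a * s)) * s ^ p.1 * s ^ p.2 := by
      have : θ + p.1 + p.2 - 1 = (θ - 1) + p.1 + p.2 := by ring
      rw [this, Real.rpow_add hs', Real.rpow_add hs', Real.rpow_natCast, Real.rpow_natCast]
      have : Real.exp (-(r * s)) = Real.exp (-s) * Real.exp (u * (a * s)) := by
        rw [← Real.exp_add, hr]; congr 1; ring
      rw [this]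
      ring
    simp only [F, C, e2]
    push_cast
    rw [div_pow, div_pow, mul_pow, mul_pow]
    ring
  have hae : ∀ᵐ s ∂(volume.restrict (Set.Ioi (0 : ℝ))), HasSum (fun p => F p s)
      (((s ^ (θ - 1) * Real.exp (-s) : ℝ) : ℂ) * wTheta θ ((s : ℂ) * z / a) *
          (Complex.exp ((u * (a * s) : ℝ) : ℂ) * g ((a : ℂ) * s))) :=
    (ae_restrict_iff' measurableSet_Ioi).2 (Eventually.of_forall hpt)
  refine ⟨integrable_tsum_of_summable F hF hFs _ hae, ?_⟩
  have hI := hasSum_integral_of_summable_integral_norm hF hFs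
  have hcongr : ∫ s in Set.Ioi (0 : ℝ), ∑' p, F p s = ∫ s in Set.Ioi (0 : ℝ),
      ((s ^ (θ - 1) * Real.exp (-s) : ℝ) : ℂ) * wTheta θ ((s : ℂ) * z / a) *
          (Complex.exp ((u * (a * s) : ℝ) : ℂ) * g ((a : ℂ) * s)) :=
    setIntegral_congr_fun measurableSet_Ioi fun s hs => (hpt s hs).tsum_eq
  rw [hcongr] at hI
  simp only [hFint] at hI
  generalize (∫ s in Set.Ioi (0 : ℝ),
      ((s ^ (θ - 1) * Real.exp (-s) : ℝ) : ℂ) * wTheta θ ((s : ℂ) * z / a) *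
          (Complex.exp ((u * (a * s) : ℝ) : ℂ) * g ((a : ℂ) * s))) = I at hI ⊢
  -- sum over `j` first
  have hI2 : HasSum (fun p : ℕ × ℕ => V (p.2, p.1)) I :=
    (Equiv.prodComm ℕ ℕ).hasSum_iff.2 hI
  have hI3 := hI2.prod_fiberwise (fun m => (kummer θ x m).mul_left
    (((r ^ (-θ) : ℝ) : ℂ) * (iteratedDeriv m g 0 * (c : ℂ) ^ m)))
  -- the double series
  let Q : ℕ × ℕ → ℂ := fun p => (c : ℂ) ^ p.2 * iteratedDeriv (p.1 + p.2) g 0 *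
    ((Ring.multichoose (θ + p.1) p.2 : ℝ) : ℂ) * (((c : ℂ) * x) ^ p.1 / (p.1.factorial : ℂ))
  have hQs : Summable Q := by
    refine Summable.of_norm_bounded
      ((mc_summable θ (c * β) (β * ‖(c : ℂ) * x‖) hθ (by positivity) hcβ (by positivity)).mul_left
        M) (fun p => ?_)
    have h1 := coefD_term_bound θ c β M hθ hc0 g hM p.1 p.2
    simp only [Q]
    rw [norm_mul, norm_div, norm_pow _ p.1, Complex.norm_natCast]
    refine (mul_le_mul_of_nonneg_right h1 (by positivity)).trans (le_of_eq ?_)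
    rw [mul_pow β]
    ring
  have hQ1 : HasSum (fun m : ℕ => ∑ p ∈ Finset.HasAntidiagonal.antidiagonal m, Q p)
      (∑' p, Q p) := by
    have h1 := (Finset.HasAntidiagonal.sigmaAntidiagonalEquivProd (A := ℕ)).hasSum_iff.2 hQs.hasSum
    have h2 := h1.sigma (fun m => hasSum_fintype _)
    refine (hasSum_congr_aux fun m => ?_).2 h2
    rw [← Finset.sum_coe_sort]
    rfl
  have hQ2 : ∑' p, Q p = expDelta θ c g (z / ((r ^ 2 : ℝ) : ℂ)) := by
    rw [hQs.tsum_prod, expDelta_eq]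
    refine tsum_congr fun n => ?_
    simp only [Q]
    rw [tsum_mul_right, coefD, mul_div_assoc]
    have : (c : ℂ) * x = z / ((r ^ 2 : ℝ) : ℂ) := by
      rw [hc, hx]
      push_cast
      field_simp
    rw [this]
  have hI4 := hQ1.mul_left (((r ^ (-θ) : ℝ) : ℂ) * Complex.exp x)
  have hIeq : I = ((r ^ (-θ) : ℝ) : ℂ) * Complex.exp x * ∑' p, Q p := by
    refine hI3.unique ((hasSum_congr_aux fun m => ?_).2 hI4)
    rw [Finset.mul_sum, Finset.mul_sum]
    refine Finset.sum_congr rfl fun p hp => ?_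
    rw [Finset.HasAntidiagonal.mem_antidiagonal] at hp
    simp only [Q]
    rw [← hp, pow_add, mul_pow]
    ring
  rw [hIeq, hQ2]
  have hexp : Complex.exp (-z / a) * Complex.exp x = Complex.exp ((u : ℂ) * z / (r : ℂ)) := by
    rw [← Complex.exp_add]
    congr 1
    have hrc : (r : ℂ) = 1 - u * a := by rw [hr]; push_cast; rfl
    rw [hx]
    field_simp
    rw [hrc]
    ring
  rw [← hexp]
  ring

theorem stmt_18 (θ a u b : ℝ) (hθ : 0 < θ) (ha : 0 < a)
    (hb0 : 0 ≤ b) (hb : b < -u + 1 / a) (g : ℂ → ℂ) (hg : InA b g) :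
    (∀ z : ℂ,
      IntegrableOn
        (fun s : ℝ => ((s ^ (θ - 1) * Real.exp (-s) : ℝ) : ℂ) * wTheta θ ((s : ℂ) * z / a) *
          (Complex.exp ((u * (a * s) : ℝ) : ℂ) * g ((a : ℂ) * s))) (Set.Ioi 0)) ∧
    (∀ z : ℂ,
      Complex.exp (-z / a) *
        ∫ s in Set.Ioi (0 : ℝ),
          ((s ^ (θ - 1) * Real.exp (-s) : ℝ) : ℂ) * wTheta θ ((s : ℂ) * z / a) *
            (Complex.exp ((u * (a * s) : ℝ) : ℂ) * g ((a : ℂ) * s)) =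
      (((1 - u * a) ^ (-θ) : ℝ) : ℂ) * Complex.exp ((u : ℂ) * z / ((1 - u * a : ℝ) : ℂ)) *
        expDelta θ (a / (1 - u * a)) g (z / (((1 - u * a) ^ 2 : ℝ) : ℂ))) ∧
    InA (b * (1 - u * a)⁻¹ * (1 - a * (u + b))⁻¹)
      (fun z => expDelta θ (a / (1 - u * a)) g (z / (((1 - u * a) ^ 2 : ℝ) : ℂ))) := by

  exact ⟨fun z => (part12 θ a u b hθ ha hb0 hb g hg z).1,
    fun z => (part12 θ a u b hθ ha hb0 hb g hg z).2, part3 θ a u b hθ ha hb0 hb g hg⟩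
end

section
/- Let θ > 0, ε ≥ 0, let h ∈ A_0 and set g(z) = e^{−εz} h(z). For t > 0 and z ∈ ℂ define f(t,z) = e^{−z/t} ∫_0^∞ s^{θ−1} e^{−s} w_θ(zs/t) g(ts) ds. Then for every t > 0 the function z ↦ f(t,z) is entire, the partial derivative ∂f/∂t(t,z) exists, and f satisfies the evolution equation ∂f/∂t(t,z) = θ ∂f/∂z(t,z) + z ∂²f/∂z²(t,z) for all t > 0 and z ∈ ℂ. -/
open Filter Topology MeasureTheory
open scoped ENNReal

lemma gamma_coef_bound {θ : ℝ} (hθ : 0 < θ) {δ : ℝ} (hδ : 0 < δ) :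
    ∃ C : ℝ, 0 < C ∧ ∀ k : ℕ, 1 / Real.Gamma (θ + k) ≤ C * δ ^ k := by
  have hG : ∀ k : ℕ, 0 < Real.Gamma (θ + k) := fun k => Real.Gamma_pos_of_pos (by positivity)
  have hpos : ∀ k : ℕ, 0 < (1 / δ) ^ k / Real.Gamma (θ + k) := fun k => by
    have := hG k
    positivity
  have hs : Summable (fun k : ℕ => (1 / δ) ^ k / Real.Gamma (θ + k)) := by
    refine summable_of_ratio_test_tendsto_lt_one (l := 0) zero_lt_one
      (Eventually.of_forall fun k => (hpos k).ne') ?_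
    have : ∀ k : ℕ, ‖(1 / δ) ^ (k + 1) / Real.Gamma (θ + (k + 1 : ℕ))‖ /
        ‖(1 / δ) ^ k / Real.Gamma (θ + k)‖ = (1 / δ) / (θ + k) := fun k => by
      rw [Real.norm_of_nonneg (hpos k).le, Real.norm_of_nonneg (hpos (k + 1)).le]
      have e : Real.Gamma (θ + (k + 1 : ℕ)) = (θ + k) * Real.Gamma (θ + k) := by
        rw [← Real.Gamma_add_one (by positivity)]
        push_cast
        ring_nf
      have h1 := (hG k).ne'
      have h2 : θ + k ≠ 0 := by positivity
      rw [e, pow_succ]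
      field_simp
    simp_rw [this]
    exact Tendsto.div_atTop tendsto_const_nhds
      (tendsto_atTop_add_const_left _ _ tendsto_natCast_atTop_atTop)
  refine ⟨∑' k : ℕ, (1 / δ) ^ k / Real.Gamma (θ + k),
    hs.tsum_pos (fun k => (hpos k).le) 0 (hpos 0), fun k => ?_⟩
  have h1 := hs.le_tsum k (fun j _ => (hpos j).le)
  have h2 := mul_le_mul_of_nonneg_right h1 (pow_pos hδ k).le
  refine le_trans (le_of_eq ?_) h2
  rw [one_div, one_div, inv_pow]
  field_simp

lemma wterm_norm_le {θ C δ R : ℝ} (hθ : 0 < θ) 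
    (hC : ∀ k : ℕ, 1 / Real.Gamma (θ + k) ≤ C * δ ^ k) {z : ℂ} (hz : ‖z‖ ≤ R) (k : ℕ) :
    ‖z ^ k / ((k.factorial : ℂ) * (Real.Gamma (θ + k) : ℂ))‖ ≤
      C * ((δ * R) ^ k / k.factorial) := by
  have hG : 0 < Real.Gamma (θ + k) := Real.Gamma_pos_of_pos (by positivity)
  have h0 : 0 ≤ R := (norm_nonneg z).trans hz
  rw [norm_div, norm_mul, norm_pow, Complex.norm_natCast, Complex.norm_real,
    Real.norm_of_nonneg hG.le]
  calc ‖z‖ ^ k / (k.factorial * Real.Gamma (θ + k)) 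
      = (‖z‖ ^ k / k.factorial) * (1 / Real.Gamma (θ + k)) := by field_simp
    _ ≤ (R ^ k / k.factorial) * (C * δ ^ k) := by
        gcongr
        exact hC k
    _ = _ := by rw [mul_pow]; ring

lemma wterm_summable_bound (C δ R : ℝ) :
    Summable (fun k : ℕ => C * ((δ * R) ^ k / k.factorial)) :=
  (Real.summable_pow_div_factorial _).mul_left C

lemma wterm_summable {θ : ℝ} (hθ : 0 < θ) (z : ℂ) :
    Summable (fun k : ℕ => z ^ k / ((k.factorial : ℂ) * (Real.Gamma (θ + k) : ℂ))) := by
  obtain ⟨C, -, hC⟩ := gamma_coef_bound hθ one_pos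
  exact Summable.of_norm_bounded (wterm_summable_bound C 1 ‖z‖)
    (fun k => wterm_norm_le hθ hC le_rfl k)

lemma wTheta_bound {θ : ℝ} (hθ : 0 < θ) {δ : ℝ} (hδ : 0 < δ) :
    ∃ C : ℝ, 0 < C ∧ ∀ z : ℂ, ‖wTheta θ z‖ ≤ C * Real.exp (δ * ‖z‖) := by
  obtain ⟨C, hC0, hC⟩ := gamma_coef_bound hθ hδ
  refine ⟨C, hC0, fun z => ?_⟩
  refine tsum_of_norm_bounded ?_ (fun k => wterm_norm_le hθ hC le_rfl k)
  rw [Real.exp_eq_exp_ℝ]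
  exact (NormedSpace.expSeries_div_hasSum_exp (δ * ‖z‖)).mul_left C

lemma wTheta_hasDerivAt {θ : ℝ} (hθ : 0 < θ) (z : ℂ) :
    HasDerivAt (wTheta θ) (wTheta (θ + 1) z) z := by
  obtain ⟨C, -, hC⟩ := gamma_coef_bound hθ one_pos
  have hz : z ∈ Metric.ball (0 : ℂ) (‖z‖ + 1) := by simp
  have hd : ∀ k : ℕ, DifferentiableOn ℂ
      (fun z : ℂ => z ^ k / ((k.factorial : ℂ) * (Real.Gamma (θ + k) : ℂ)))
      (Metric.ball (0 : ℂ) (‖z‖ + 1)) := fun k => by fun_prop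
  have hb : ∀ (k : ℕ) (x : ℂ), x ∈ Metric.ball (0 : ℂ) (‖z‖ + 1) →
      ‖x ^ k / ((k.factorial : ℂ) * (Real.Gamma (θ + k) : ℂ))‖ ≤
        C * ((1 * (‖z‖ + 1)) ^ k / k.factorial) := fun k x hx =>
    wterm_norm_le hθ hC (by simpa using (Metric.mem_ball.1 hx).le) k
  have hs := wterm_summable_bound C 1 (‖z‖ + 1)
  have h1 := Complex.differentiableOn_tsum_of_summable_norm hs hd Metric.isOpen_ball hb
  have h2 := Complex.hasSum_deriv_of_summable_norm hs hd Metric.isOpen_ball hb hz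
  have h3 := (h1.differentiableAt (Metric.isOpen_ball.mem_nhds hz)).hasDerivAt
  have e : deriv (fun w : ℂ => ∑' k : ℕ, w ^ k / ((k.factorial : ℂ) * (Real.Gamma (θ + k) : ℂ))) z
      = wTheta (θ + 1) z := by
    rw [← h2.tsum_eq, h2.summable.tsum_eq_zero_add, wTheta]
    simp only [pow_zero, deriv_const, zero_add]
    refine tsum_congr fun k => ?_
    simp only [deriv_div_const, deriv_pow_field, Nat.add_sub_cancel, Nat.factorial_succ]
    have e : Real.Gamma (θ + (k + 1 : ℕ)) = Real.Gamma (θ + 1 + k) := by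
      push_cast
      ring_nf
    have hG : (Real.Gamma (θ + 1 + k) : ℂ) ≠ 0 := by
      exact_mod_cast (Real.Gamma_pos_of_pos (by positivity)).ne'
    have hk : (k : ℂ) + 1 ≠ 0 := by exact_mod_cast k.succ_ne_zero
    have hf : (k.factorial : ℂ) ≠ 0 := by exact_mod_cast k.factorial_ne_zero
    rw [e]
    push_cast
    field_simp
  rw [e] at h3
  exact h3

lemma wTheta_continuous {θ : ℝ} (hθ : 0 < θ) : Continuous (wTheta θ) :=
  continuous_iff_continuousAt.2 fun z => (wTheta_hasDerivAt hθ z).continuousAt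

lemma wTheta_ode {θ : ℝ} (hθ : 0 < θ) (z : ℂ) :
    wTheta θ z = θ * wTheta (θ + 1) z + z * wTheta (θ + 1 + 1) z := by
  have s0 := wterm_summable hθ z
  have s1 := wterm_summable (θ := θ + 1) (by positivity) z
  have s2 := wterm_summable (θ := θ + 1 + 1) (by positivity) z
  have s1' := (summable_nat_add_iff 1).2 s1
  rw [wTheta, wTheta, wTheta, s0.tsum_eq_zero_add, s1.tsum_eq_zero_add, mul_add, ← tsum_mul_left,
    ← tsum_mul_left, add_assoc, ← (s1'.mul_left _).tsum_add (s2.mul_left _)]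
  congr 1
  · have hG : Real.Gamma θ ≠ 0 := (Real.Gamma_pos_of_pos hθ).ne'
    have := Real.Gamma_add_one hθ.ne'
    have h1 : (θ : ℂ) ≠ 0 := by exact_mod_cast hθ.ne'
    have h2 : (Real.Gamma θ : ℂ) ≠ 0 := by exact_mod_cast hG
    simp only [Nat.cast_zero, add_zero, this, pow_zero, Nat.factorial_zero]
    push_cast
    field_simp
  · refine tsum_congr fun k => ?_
    have hp : 0 < θ + 1 + k := by positivity
    have hG : Real.Gamma (θ + 1 + k) ≠ 0 := (Real.Gamma_pos_of_pos hp).ne'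
    have e0 : Real.Gamma (θ + (k + 1 : ℕ)) = Real.Gamma (θ + 1 + k) := by
      push_cast
      ring_nf
    have e1 : Real.Gamma (θ + 1 + (k + 1 : ℕ)) = (θ + 1 + k) * Real.Gamma (θ + 1 + k) := by
      rw [← Real.Gamma_add_one hp.ne']
      push_cast
      ring_nf
    have e2 : Real.Gamma (θ + 1 + 1 + k) = (θ + 1 + k) * Real.Gamma (θ + 1 + k) := by
      rw [← Real.Gamma_add_one hp.ne']
      ring_nf
    have hG' : (Real.Gamma (θ + 1 + k) : ℂ) ≠ 0 := by exact_mod_cast hG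
    have hk : (k : ℂ) + 1 ≠ 0 := by exact_mod_cast k.succ_ne_zero
    have hf : (k.factorial : ℂ) ≠ 0 := by exact_mod_cast k.factorial_ne_zero
    have hp' : (θ : ℂ) + 1 + k ≠ 0 := by exact_mod_cast hp.ne'
    rw [e0, e1, e2, Nat.factorial_succ]
    push_cast
    field_simp
    ring

lemma InA_bound {h : ℂ → ℂ} (hh : InA 0 h) {δ : ℝ} (hδ : 0 < δ) :
    ∃ C : ℝ, 0 < C ∧ ∀ z : ℂ, ‖h z‖ ≤ C * Real.exp (δ * ‖z‖) := by
  have hlt := hh.2 δ hδ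
  set C := (normB δ h).toReal with hCdef
  have hC : ∀ k : ℕ, ‖iteratedDeriv k h 0‖ ≤ C * δ ^ k := fun k => by
    have h1 : ENNReal.ofReal (‖iteratedDeriv k h 0‖ / δ ^ k) ≤ normB δ h :=
      le_iSup (fun k : ℕ => ENNReal.ofReal (‖iteratedDeriv k h 0‖ / δ ^ k)) k
    have h2 := (ENNReal.ofReal_le_iff_le_toReal hlt.ne).1 h1
    exact (div_le_iff₀ (pow_pos hδ k)).1 h2
  have hC0 : 0 ≤ C := ENNReal.toReal_nonneg
  refine ⟨C + 1, by positivity, fun z => ?_⟩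
  have hT := Complex.hasSum_taylorSeries_of_entire hh.1 0 z
  have h3 : ‖h z‖ ≤ C * Real.exp (δ * ‖z‖) := by
    rw [← hT.tsum_eq]
    refine tsum_of_norm_bounded (g := fun k : ℕ => C * ((δ * ‖z‖) ^ k / k.factorial)) ?_ (fun k => ?_)
    · rw [Real.exp_eq_exp_ℝ]
      exact (NormedSpace.expSeries_div_hasSum_exp (δ * ‖z‖)).mul_left C
    · rw [norm_smul, norm_smul, norm_inv, norm_pow, Complex.norm_natCast, sub_zero]
      calc ((k.factorial : ℝ))⁻¹ * (‖z‖ ^ k * ‖iteratedDeriv k h 0‖)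
          ≤ ((k.factorial : ℝ))⁻¹ * (‖z‖ ^ k * (C * δ ^ k)) := by
            gcongr
            exact hC k
        _ = _ := by rw [mul_pow]; ring
  refine h3.trans ?_
  gcongr
  linarith

/-- The integrand after the change of variables. -/
noncomputable def kernJ (γ : ℝ → ℂ) (a ν : ℝ) (p q : ℂ) (u : ℝ) : ℂ :=
  ((u ^ (a - 1) : ℝ) : ℂ) * Complex.exp (-p * u) * wTheta ν (q * u) * γ u

/-- The parameter integral after the change of variables. -/
noncomputable def intJ (γ : ℝ → ℂ) (a ν : ℝ) (p q : ℂ) : ℂ :=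
  ∫ u in Set.Ioi (0 : ℝ), kernJ γ a ν p q u

/-- Subexponential growth on the positive half line. -/
def SubExp (γ : ℝ → ℂ) : Prop :=
  ∀ δ > 0, ∃ C : ℝ, 0 < C ∧ ∀ u : ℝ, 0 < u → ‖γ u‖ ≤ C * Real.exp (δ * u)

lemma kernJ_bound {γ : ℝ → ℂ} (hγ : SubExp γ) (a : ℝ) {ν : ℝ} (hν : 0 < ν) {c Q : ℝ}
    (hc : 0 < c) (hQ : 0 < Q) :
    ∃ C : ℝ, 0 < C ∧ ∀ (p q : ℂ) (u : ℝ), c ≤ p.re → ‖q‖ ≤ Q → 0 < u →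
      ‖kernJ γ a ν p q u‖ ≤ C * (u ^ (a - 1) * Real.exp (-(c / 2) * u)) := by
  obtain ⟨C1, hC1, h1⟩ := wTheta_bound hν (δ := c / 4 / Q) (by positivity)
  obtain ⟨C2, hC2, h2⟩ := hγ (c / 4) (by positivity)
  refine ⟨C1 * C2, by positivity, fun p q u hp hq hu => ?_⟩
  have hw : ‖wTheta ν (q * u)‖ ≤ C1 * Real.exp (c / 4 * u) := by
    refine (h1 _).trans ?_
    rw [norm_mul, Complex.norm_real, Real.norm_of_nonneg hu.le]
    have hle : c / 4 / Q * (‖q‖ * u) ≤ c / 4 * u := by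
      calc c / 4 / Q * (‖q‖ * u) ≤ c / 4 / Q * (Q * u) := by gcongr
        _ = c / 4 * u := by field_simp
    exact mul_le_mul_of_nonneg_left (Real.exp_le_exp.2 hle) hC1.le
  have he : ‖Complex.exp (-p * u)‖ ≤ Real.exp (-c * u) := by
    rw [Complex.norm_exp]
    gcongr
    simp only [Complex.mul_re, Complex.neg_re, Complex.ofReal_re, Complex.ofReal_im, mul_zero,
      sub_zero]
    nlinarith
  rw [kernJ, norm_mul, norm_mul, norm_mul, Complex.norm_real,
    Real.norm_of_nonneg (Real.rpow_nonneg hu.le _)]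
  calc u ^ (a - 1) * ‖Complex.exp (-p * u)‖ * ‖wTheta ν (q * u)‖ * ‖γ u‖
      ≤ u ^ (a - 1) * Real.exp (-c * u) * (C1 * Real.exp (c / 4 * u)) *
          (C2 * Real.exp (c / 4 * u)) := by
        gcongr
        exact h2 u hu
    _ = C1 * C2 * (u ^ (a - 1) *
          (Real.exp (-c * u) * Real.exp (c / 4 * u) * Real.exp (c / 4 * u))) := by ring
    _ = _ := by
        rw [← Real.exp_add, ← Real.exp_add]
        ring_nf

lemma bound_integrable {a c : ℝ} (ha : 0 < a) (hc : 0 < c) :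
    IntegrableOn (fun u : ℝ => u ^ (a - 1) * Real.exp (-c * u)) (Set.Ioi 0) := by
  simpa using integrableOn_rpow_mul_exp_neg_mul_rpow (p := 1) (s := a - 1) (b := c)
    (by linarith) one_pos hc

lemma kernJ_meas {γ : ℝ → ℂ} (hγc : Continuous γ) (a : ℝ) {ν : ℝ} (hν : 0 < ν) (p q : ℂ) :
    AEStronglyMeasurable (kernJ γ a ν p q) (volume.restrict (Set.Ioi 0)) := by
  refine ContinuousOn.aestronglyMeasurable ?_ measurableSet_Ioi
  unfold kernJ
  have hw := wTheta_continuous hν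
  refine ((ContinuousOn.mul ?_ (by fun_prop)).mul (by fun_prop)).mul hγc.continuousOn
  refine Complex.continuous_ofReal.comp_continuousOn ?_
  exact continuousOn_id.rpow_const fun x hx => Or.inl (ne_of_gt hx)

lemma kernJ_integrable {γ : ℝ → ℂ} (hγc : Continuous γ) (hγ : SubExp γ) {a ν : ℝ} (ha : 0 < a)
    (hν : 0 < ν) {p : ℂ} (hp : 0 < p.re) (q : ℂ) :
    IntegrableOn (kernJ γ a ν p q) (Set.Ioi 0) := by
  obtain ⟨C, -, hC⟩ := kernJ_bound hγ a hν hp (Q := ‖q‖ + 1) (by positivity)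
  refine Integrable.mono' ((bound_integrable ha (half_pos hp)).const_mul C)
    (kernJ_meas hγc a hν p q) ?_
  filter_upwards [ae_restrict_mem measurableSet_Ioi] with u hu
  exact hC p q u le_rfl (by linarith) hu

lemma kernJ_succ (γ : ℝ → ℂ) (a ν : ℝ) (p q : ℂ) {u : ℝ} (hu : 0 < u) :
    kernJ γ (a + 1) ν p q u = u * kernJ γ a ν p q u := by
  unfold kernJ
  have : u ^ (a + 1 - 1) = u * u ^ (a - 1) := by
    rw [show a + 1 - 1 = 1 + (a - 1) by ring, Real.rpow_add hu, Real.rpow_one]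
  rw [this]
  push_cast
  ring

lemma intJ_hasDerivAt {γ : ℝ → ℂ} (hγc : Continuous γ) (hγ : SubExp γ) {a ν : ℝ} (ha : 0 < a)
    (hν : 0 < ν) {p q p' q' : ℂ → ℂ} {x₀ : ℂ} (hp : 0 < (p x₀).re)
    (hpd : ∀ᶠ x in 𝓝 x₀, HasDerivAt p (p' x) x) (hqd : ∀ᶠ x in 𝓝 x₀, HasDerivAt q (q' x) x)
    (hpc : ContinuousAt p' x₀) (hqc : ContinuousAt q' x₀) :
    HasDerivAt (fun x => intJ γ a ν (p x) (q x))
      (-p' x₀ * intJ γ (a + 1) ν (p x₀) (q x₀) + q' x₀ * intJ γ (a + 1) (ν + 1) (p x₀) (q x₀))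
      x₀ := by
  set c := (p x₀).re / 2 with hcdef
  have hc : 0 < c := half_pos hp
  set Q := ‖q x₀‖ + 1 with hQ
  set B1 := ‖p' x₀‖ + 1 with hB1
  set B2 := ‖q' x₀‖ + 1 with hB2
  have hp0 := hpd.self_of_nhds.continuousAt
  have hq0 := hqd.self_of_nhds.continuousAt
  have ev1 : ∀ᶠ x in 𝓝 x₀, c ≤ (p x).re :=
    (Complex.continuous_re.continuousAt.comp hp0).eventually_const_le (half_lt_self hp)
  have ev2 : ∀ᶠ x in 𝓝 x₀, ‖q x‖ ≤ Q := hq0.norm.eventually_le_const (by simp [hQ])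
  have ev3 : ∀ᶠ x in 𝓝 x₀, ‖p' x‖ ≤ B1 := hpc.norm.eventually_le_const (by simp [hB1])
  have ev4 : ∀ᶠ x in 𝓝 x₀, ‖q' x‖ ≤ B2 := hqc.norm.eventually_le_const (by simp [hB2])
  obtain ⟨C1, hC1, h1⟩ := kernJ_bound hγ (a + 1) hν hc (Q := Q) (by positivity)
  obtain ⟨C2, hC2, h2⟩ := kernJ_bound hγ (a + 1) (ν := ν + 1) (by positivity) hc (Q := Q)
    (by positivity)
  have ha1 : 0 < a + 1 := by positivity
  have hν1 : 0 < ν + 1 := by positivity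
  have hI1 := kernJ_integrable hγc hγ ha1 hν hp (q x₀)
  have hI2 := kernJ_integrable hγc hγ ha1 hν1 hp (q x₀)
  have key := (hasDerivAt_integral_of_dominated_loc_of_deriv_le
    (μ := volume.restrict (Set.Ioi (0 : ℝ)))
    (F := fun x u => kernJ γ a ν (p x) (q x) u)
    (F' := fun x u => -p' x * kernJ γ (a + 1) ν (p x) (q x) u +
      q' x * kernJ γ (a + 1) (ν + 1) (p x) (q x) u)
    (bound := fun u => (B1 * C1 + B2 * C2) * (u ^ (a + 1 - 1) * Real.exp (-(c / 2) * u)))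
    (ev1.and (ev2.and (ev3.and (ev4.and (hpd.and hqd)))))
    (Eventually.of_forall fun x => kernJ_meas hγc a hν _ _)
    (kernJ_integrable hγc hγ ha hν hp _)
    ((hI1.const_mul _).add (hI2.const_mul _)).aestronglyMeasurable
    ?_ ((bound_integrable ha1 (half_pos hc)).const_mul _) ?_).2
  · have e : ∫ u in Set.Ioi (0 : ℝ), (-p' x₀ * kernJ γ (a + 1) ν (p x₀) (q x₀) u +
      q' x₀ * kernJ γ (a + 1) (ν + 1) (p x₀) (q x₀) u) =
      -p' x₀ * intJ γ (a + 1) ν (p x₀) (q x₀) + q' x₀ * intJ γ (a + 1) (ν + 1) (p x₀) (q x₀) := by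
      rw [integral_add (hI1.const_mul _) (hI2.const_mul _), integral_const_mul,
        integral_const_mul]
      rfl
    rw [e] at key
    exact key
  · filter_upwards [ae_restrict_mem measurableSet_Ioi] with u hu
    rintro x ⟨e1, e2, e3, e4, -, -⟩
    refine (norm_add_le _ _).trans ?_
    rw [norm_mul, norm_mul, norm_neg, add_mul, mul_assoc, mul_assoc]
    have k1 := h1 (p x) (q x) u e1 e2 hu
    have k2 := h2 (p x) (q x) u e1 e2 hu
    gcongr
  · filter_upwards [ae_restrict_mem measurableSet_Ioi] with u hu
    rintro x ⟨-, -, -, -, e5, e6⟩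
    rw [kernJ_succ _ _ _ _ _ hu, kernJ_succ _ _ _ _ _ hu]
    unfold kernJ
    have d1 : HasDerivAt (fun x => Complex.exp (-p x * u))
        (Complex.exp (-p x * u) * (-p' x * u)) x := (e5.neg.mul_const (u : ℂ)).cexp
    have d2 : HasDerivAt (fun x => wTheta ν (q x * u)) (wTheta (ν + 1) (q x * u) * (q' x * u)) x :=
      HasDerivAt.comp (h₂ := wTheta ν) x (wTheta_hasDerivAt hν (q x * u)) (e6.mul_const (u : ℂ))
    have d3 := ((d1.const_mul ((u ^ (a - 1) : ℝ) : ℂ)).mul d2).mul_const (γ u)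
    refine d3.congr_deriv ?_
    ring

lemma intJ_ode {γ : ℝ → ℂ} (hγc : Continuous γ) (hγ : SubExp γ) {a ν : ℝ} (ha : 0 < a)
    (hν : 0 < ν) {p : ℂ} (hp : 0 < p.re) (q : ℂ) :
    intJ γ a ν p q = ν * intJ γ a (ν + 1) p q + q * intJ γ (a + 1) (ν + 1 + 1) p q := by
  have hI1 := kernJ_integrable hγc hγ ha (ν := ν + 1) (by positivity) hp q
  have hI2 := kernJ_integrable hγc hγ (a := a + 1) (by positivity) (ν := ν + 1 + 1)
    (by positivity) hp q
  unfold intJ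
  rw [← integral_const_mul, ← integral_const_mul, ← integral_add (hI1.const_mul _)
    (hI2.const_mul _)]
  refine setIntegral_congr_fun measurableSet_Ioi fun u hu => ?_
  rw [kernJ_succ _ _ _ _ _ hu]
  unfold kernJ
  rw [wTheta_ode hν]
  ring

lemma F_eq {θ : ℝ} {g : ℂ → ℂ} {t : ℝ} (ht : 0 < t) (z : ℂ) :
    ∫ s in Set.Ioi (0 : ℝ),
        ((s ^ (θ - 1) * Real.exp (-s) : ℝ) : ℂ) * wTheta θ (z * (s : ℂ) / (t : ℂ)) *
          g (((t * s : ℝ) : ℂ)) =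
      (t : ℂ) ^ (-(θ : ℂ)) * intJ (fun u => g u) θ θ ((t : ℂ)⁻¹) (z / (t : ℂ) ^ 2) := by
  have htc : (t : ℂ) ≠ 0 := by exact_mod_cast ht.ne'
  have h1 := integral_comp_mul_left_Ioi
    (kernJ (fun u => g u) θ θ ((t : ℂ)⁻¹) (z / (t : ℂ) ^ 2)) 0 ht
  rw [mul_zero] at h1
  have h2 : intJ (fun u => g u) θ θ ((t : ℂ)⁻¹) (z / (t : ℂ) ^ 2) =
      (t : ℂ) * ∫ s in Set.Ioi (0 : ℝ),
        kernJ (fun u => g u) θ θ ((t : ℂ)⁻¹) (z / (t : ℂ) ^ 2) (t * s) := by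
    rw [h1, intJ, Complex.real_smul]
    push_cast
    field_simp
  rw [h2, ← mul_assoc, ← integral_const_mul]
  refine setIntegral_congr_fun measurableSet_Ioi fun s hs => ?_
  have hs' : 0 < s := hs
  simp only [kernJ]
  have e1 : -(t : ℂ)⁻¹ * ((t * s : ℝ) : ℂ) = ((-s : ℝ) : ℂ) := by
    push_cast
    field_simp
  have e2 : z / (t : ℂ) ^ 2 * ((t * s : ℝ) : ℂ) = z * s / t := by
    push_cast
    field_simp
  have e3 : (t : ℂ) ^ (-(θ : ℂ)) = ((t ^ (-θ) : ℝ) : ℂ) := by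
    rw [Complex.ofReal_cpow ht.le]
    push_cast
    rfl
  have e4 : t ^ (-θ) * t * (t * s) ^ (θ - 1) = s ^ (θ - 1) := by
    rw [Real.mul_rpow ht.le hs'.le, ← mul_assoc]
    nth_rewrite 2 [← Real.rpow_one t]
    rw [← Real.rpow_add ht, ← Real.rpow_add ht]
    simp
  rw [e1, e2, e3, ← e4, Complex.ofReal_mul, Complex.ofReal_exp]
  push_cast
  ring

theorem stmt_19 (θ ε : ℝ) (hθ : 0 < θ) (hε : 0 ≤ ε) (h : ℂ → ℂ) (hh : InA 0 h)
    (g : ℂ → ℂ) (hg : ∀ z : ℂ, g z = Complex.exp (-(ε : ℂ) * z) * h z)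
    (F : ℝ → ℂ → ℂ)
    (hF : ∀ t : ℝ, ∀ z : ℂ, F t z = Complex.exp (-z / (t : ℂ)) *
      ∫ s in Set.Ioi (0 : ℝ),
        ((s ^ (θ - 1) * Real.exp (-s) : ℝ) : ℂ) * wTheta θ (z * (s : ℂ) / (t : ℂ)) *
          g (((t * s : ℝ) : ℂ))) :
    ∀ t : ℝ, 0 < t →
      Differentiable ℂ (F t) ∧
      ∀ z : ℂ, HasDerivAt (fun τ : ℝ => F τ z)
        ((θ : ℂ) * deriv (F t) z + z * deriv (deriv (F t)) z) t := by
  have hgc : Continuous g := by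
    have : g = fun z => Complex.exp (-(ε : ℂ) * z) * h z := funext hg
    rw [this]
    have := hh.1.continuous
    fun_prop
  set γ : ℝ → ℂ := fun u => g u with hγdef
  have hγc : Continuous γ := hgc.comp Complex.continuous_ofReal
  have hγ : SubExp γ := by
    intro δ hδ
    obtain ⟨C, hC, hb⟩ := InA_bound hh hδ
    refine ⟨C, hC, fun u hu => ?_⟩
    have h1 : ‖Complex.exp (-(ε : ℂ) * u)‖ ≤ 1 := by
      rw [Complex.norm_exp, Real.exp_le_one_iff]
      simp
      positivity
    have h2 := hb u
    rw [Complex.norm_real, Real.norm_of_nonneg hu.le] at h2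
    simp only [hγdef]
    rw [hg, norm_mul]
    calc _ ≤ 1 * (C * Real.exp (δ * u)) := by gcongr
      _ = _ := one_mul _
  have hF' : ∀ t : ℝ, 0 < t → ∀ z : ℂ, F t z = Complex.exp (-z / (t : ℂ)) *
      ((t : ℂ) ^ (-(θ : ℂ)) * intJ γ θ θ ((t : ℂ)⁻¹) (z / (t : ℂ) ^ 2)) := fun t ht z => by
    rw [hF, F_eq ht]
  intro t ht
  have htc : (t : ℂ) ≠ 0 := by exact_mod_cast ht.ne'
  have hre : 0 < ((t : ℂ)⁻¹).re := by
    rw [← Complex.ofReal_inv, Complex.ofReal_re]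
    positivity
  have dz : ∀ a ν : ℝ, 0 < a → 0 < ν → ∀ z : ℂ,
      HasDerivAt (fun z => intJ γ a ν ((t : ℂ)⁻¹) (z / (t : ℂ) ^ 2))
        (1 / (t : ℂ) ^ 2 * intJ γ (a + 1) (ν + 1) ((t : ℂ)⁻¹) (z / (t : ℂ) ^ 2)) z := by
    intro a ν ha hν z
    have := intJ_hasDerivAt hγc hγ ha hν (p := fun _ => (t : ℂ)⁻¹) (p' := fun _ => 0)
      (q := fun z => z / (t : ℂ) ^ 2) (q' := fun _ => 1 / (t : ℂ) ^ 2) (x₀ := z) hre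
      (Eventually.of_forall fun x => hasDerivAt_const _ _)
      (Eventually.of_forall fun x => (hasDerivAt_id x).div_const _)
      continuousAt_const continuousAt_const
    simpa using this
  have de : ∀ z : ℂ, HasDerivAt (fun z : ℂ => Complex.exp (-z / (t : ℂ)))
      (Complex.exp (-z / (t : ℂ)) * (-1 / (t : ℂ))) z := fun z =>
    ((hasDerivAt_id z).neg.div_const (t : ℂ)).cexp
  have d1 : ∀ z : ℂ, HasDerivAt (F t) (Complex.exp (-z / (t : ℂ)) * (-1 / (t : ℂ)) *
      ((t : ℂ) ^ (-(θ : ℂ)) * intJ γ θ θ ((t : ℂ)⁻¹) (z / (t : ℂ) ^ 2)) +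
      Complex.exp (-z / (t : ℂ)) * ((t : ℂ) ^ (-(θ : ℂ)) *
        (1 / (t : ℂ) ^ 2 * intJ γ (θ + 1) (θ + 1) ((t : ℂ)⁻¹) (z / (t : ℂ) ^ 2)))) z := by
    intro z
    rw [show F t = _ from funext (hF' t ht)]
    exact (de z).mul ((dz θ θ hθ hθ z).const_mul _)
  refine ⟨fun z => (d1 z).differentiableAt, fun z => ?_⟩
  have hθ1 : 0 < θ + 1 := by positivity
  have d2 := (((de z).mul_const (-1 / (t : ℂ))).mul
    ((dz θ θ hθ hθ z).const_mul ((t : ℂ) ^ (-(θ : ℂ))))).add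
    ((de z).mul (((dz (θ + 1) (θ + 1) hθ1 hθ1 z).const_mul (1 / (t : ℂ) ^ 2)).const_mul
      ((t : ℂ) ^ (-(θ : ℂ)))))
  have d2' := HasDerivAt.congr_of_eventuallyEq (f₁ := deriv (F t)) d2
    (Eventually.of_forall fun y => (d1 y).deriv)
  rw [d2'.deriv, (d1 z).deriv]
  have hne : ∀ᶠ x in 𝓝 (t : ℂ), x ≠ 0 := isOpen_ne.mem_nhds htc
  have t1 : HasDerivAt (fun x : ℂ => Complex.exp (-z / x))
      (Complex.exp (-z / (t : ℂ)) * (z / (t : ℂ) ^ 2)) (t : ℂ) := by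
    have := ((hasDerivAt_inv htc).const_mul (-z)).cexp
    simp only [← div_eq_mul_inv] at this
    refine this.congr_deriv ?_
    ring
  have t2 : HasDerivAt (fun x : ℂ => x ^ (-(θ : ℂ)))
      ((t : ℂ) ^ (-(θ : ℂ)) * (-(θ : ℂ) / t)) (t : ℂ) := by
    have := (hasDerivAt_id (t : ℂ)).cpow_const (c := -(θ : ℂ)) (Or.inl (by simpa using ht))
    refine this.congr_deriv ?_
    simp only [id]
    rw [Complex.cpow_sub _ _ htc, Complex.cpow_one]
    ring
  have t3 := intJ_hasDerivAt hγc hγ hθ hθ (p := fun x => x⁻¹) (p' := fun x => -(x ^ 2)⁻¹)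
      (q := fun x => z / x ^ 2) (q' := fun x => -(2 * z) / x ^ 3) (x₀ := (t : ℂ)) hre
      (hne.mono fun x hx => hasDerivAt_inv hx)
      (hne.mono fun x hx => by
        have := ((hasDerivAt_pow 2 x).inv (pow_ne_zero 2 hx)).const_mul z
        simp only [div_eq_mul_inv]
        refine this.congr_deriv ?_
        field_simp
        norm_num
        ring)
      (ContinuousAt.neg (ContinuousAt.inv₀ (by fun_prop) (pow_ne_zero 2 htc)))
      (ContinuousAt.div (by fun_prop) (by fun_prop) (pow_ne_zero 3 htc))
  have t4 := (t1.mul (t2.mul t3)).comp_ofReal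
  have ev : (fun τ : ℝ => F τ z) =ᶠ[𝓝 t] fun τ : ℝ => Complex.exp (-z / (τ : ℂ)) *
      ((τ : ℂ) ^ (-(θ : ℂ)) * intJ γ θ θ ((τ : ℂ)⁻¹) (z / (τ : ℂ) ^ 2)) := by
    filter_upwards [lt_mem_nhds ht] with τ hτ
    exact hF' τ hτ z
  refine HasDerivAt.congr_of_eventuallyEq ?_ ev
  refine t4.congr_deriv ?_
  have ode := intJ_ode hγc hγ hθ1 hθ hre (z / (t : ℂ) ^ 2)
  rw [ode]
  simp only [Pi.mul_apply]
  field_simp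
  ring
end
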